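/- There exists a constant C > 0 depending only on s and c₀ such that for every quadruple (ξ₁, ξ₂, ξ₃, ξ₄) of real numbers with ξ₁ + ξ₂ + ξ₃ + ξ₄ = 0 and α₃(ξ₁+ξ₄, ξ₂, ξ₃) ≠ 0, the quantity M₄₁(ξ₁,ξ₂,ξ₃,ξ₄) := (1/2)·(ξ₁+ξ₄)·σ₃(ξ₁+ξ₄, ξ₂, ξ₃) satisfies |M₄₁(ξ₁,ξ₂,ξ₃,ξ₄)| ≤ C·N_max^{2s−1}·N^{2−2s}, where N_max := max(|ξ₁|,|ξ₂|,|ξ₃|,|ξ₄|). -/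

import Mathlib

open MeasureTheory Real

noncomputable section

/-- An admissible I-method multiplier `m`, with parameters `s`, `N`, `c₀`. -/
structure AdmissibleMultiplier (s N c₀ : ℝ) (m : ℝ → ℝ) : Prop where
  even : ∀ ξ : ℝ, m (-ξ) = m ξ
  smooth : ContDiff ℝ 2 m
  anti : ∀ ⦃a b : ℝ⦄, 0 ≤ a → a ≤ b → m b ≤ m a
  pos : ∀ ξ : ℝ, 0 < m ξ
  le_one : ∀ ξ : ℝ, m ξ ≤ 1
  eq_one : ∀ ξ : ℝ, |ξ| ≤ N → m ξ = 1
  eq_rpow : ∀ ξ : ℝ, 2 * N ≤ |ξ| → m ξ = N ^ (1 - s) * |ξ| ^ (s - 1)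
  cube_mono : ∀ ⦃a b : ℝ⦄, 0 ≤ a → a ≤ b → a ^ 3 * m a ^ 2 ≤ b ^ 3 * m b ^ 2
  deriv_le : ∀ ξ : ℝ, ξ ≠ 0 → |deriv m ξ| ≤ c₀ * m ξ / |ξ|
  deriv2_le : ∀ ξ : ℝ, ξ ≠ 0 → |deriv (deriv m) ξ| ≤ c₀ * m ξ / ξ ^ 2

/-- The denominator `α₃(ξ₁,ξ₂,ξ₃) = ξ₁³ + 4ξ₂³ + 4ξ₃³`. -/
def alpha3 (ξ₁ ξ₂ ξ₃ : ℝ) : ℝ := ξ₁ ^ 3 + 4 * ξ₂ ^ 3 + 4 * ξ₃ ^ 3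

/-- The multiplier `σ₃` associated with `m₁` (and `m₂(ξ) = m₁(2ξ)`); equal to `0`
by the junk-value convention where `α₃` vanishes. -/
def sigma3 (m₁ : ℝ → ℝ) (ξ₁ ξ₂ ξ₃ : ℝ) : ℝ :=
  (ξ₁ ^ 3 * m₁ ξ₁ ^ 2 + 4 * ξ₂ ^ 3 * m₁ (2 * ξ₂) ^ 2 + 4 * ξ₃ ^ 3 * m₁ (2 * ξ₃) ^ 2) /
    alpha3 ξ₁ ξ₂ ξ₃

/-- Midpoint second differences are controlled by a bound on the second derivative. -/
lemma abs_add_sub_two_mul_midpoint_le {f f' f'' : ℝ → ℝ} {R K : ℝ}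
    (hf : ∀ t, HasDerivAt f (f' t) t) (hf' : ∀ t, HasDerivAt f' (f'' t) t)
    (hK : ∀ t, |t| ≤ R → |f'' t| ≤ K) {a b : ℝ} (ha : |a| ≤ R / 2) (hb : |b| ≤ R / 2) :
    |f (2 * a) + f (2 * b) - 2 * f (a + b)| ≤ 2 * K * (a - b) ^ 2 := by
  rw [abs_le] at ha hb
  have hK0 : 0 ≤ K := (abs_nonneg _).trans (hK 0 (by rw [abs_zero]; linarith))
  have hlip : ∀ x ∈ Set.Icc (-R) R, ∀ y ∈ Set.Icc (-R) R, |f' y - f' x| ≤ K * |y - x| :=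
    fun x hx y hy => (convex_Icc (-R) R).norm_image_sub_le_of_norm_hasDerivWithin_le
      (fun t _ => (hf' t).hasDerivWithinAt) (fun t ht => hK t (abs_le.2 ht)) hx hy
  have hmem : ∀ u ∈ Set.Icc (0 : ℝ) 1,
      a + b + u * (a - b) ∈ Set.Icc (-R) R ∧ a + b - u * (a - b) ∈ Set.Icc (-R) R := by
    rintro u ⟨hu0, hu1⟩
    refine ⟨⟨?_, ?_⟩, ⟨?_, ?_⟩⟩ <;> nlinarith
  have hφ : ∀ u, HasDerivAt (fun u => f (a + b + u * (a - b)) + f (a + b - u * (a - b)))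
      (f' (a + b + u * (a - b)) * (a - b) - f' (a + b - u * (a - b)) * (a - b)) u := by
    intro u
    have h := (hasDerivAt_id u).mul_const (a - b)
    have h1 := (hf (a + b + u * (a - b))).comp u (h.const_add (a + b))
    have h2 := (hf (a + b - u * (a - b))).comp u (h.const_sub (a + b))
    refine (h1.fun_add h2).congr_deriv ?_
    ring
  have key := (convex_Icc (0 : ℝ) 1).norm_image_sub_le_of_norm_hasDerivWithin_le
    (C := 2 * K * (a - b) ^ 2) (fun u _ => (hφ u).hasDerivWithinAt) ?_
    (Set.left_mem_Icc.2 zero_le_one) (Set.right_mem_Icc.2 zero_le_one)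
  · beta_reduce at key
    rw [Real.norm_eq_abs, show a + b + 1 * (a - b) = 2 * a by ring,
      show a + b - 1 * (a - b) = 2 * b by ring, zero_mul, add_zero, sub_zero, sub_zero,
      norm_one, mul_one, ← two_mul] at key
    exact key
  · intro u hu
    obtain ⟨hp, hm⟩ := hmem u hu
    have h := hlip _ hm _ hp
    rw [show a + b + u * (a - b) - (a + b - u * (a - b)) = 2 * u * (a - b) by ring, abs_mul,
      abs_of_nonneg (by linarith [hu.1] : 0 ≤ 2 * u)] at h
    rw [Real.norm_eq_abs, ← sub_mul, abs_mul]
    calc _ ≤ K * (2 * u * |a - b|) * |a - b| := by gcongr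
      _ = 2 * K * (a - b) ^ 2 * u := by rw [← sq_abs (a - b)]; ring
      _ ≤ 2 * K * (a - b) ^ 2 * 1 := by
        gcongr
        exact hu.2
      _ = _ := mul_one _

namespace AdmissibleMultiplier

variable {s N c₀ : ℝ} {m : ℝ → ℝ}

lemma abs_mul_sq_le (hm : AdmissibleMultiplier s N c₀ m) (hs : 1 / 2 ≤ s) (hs1 : s < 1)
    (hN : 0 < N) (t : ℝ) :
    |t| * m t ^ 2 ≤ 2 * N ^ (2 - 2 * s) * |t| ^ (2 * s - 1) := by
  rcases (abs_nonneg t).eq_or_lt with ht | ht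
  · rw [← ht, zero_mul]
    positivity
  rcases le_total |t| (2 * N) with h | h
  · have hsplit : |t| = |t| ^ (2 - 2 * s) * |t| ^ (2 * s - 1) := by
      rw [← Real.rpow_add ht]
      ring_nf
      rw [Real.rpow_one]
    have h2 : (2 : ℝ) ^ (2 - 2 * s) ≤ 2 := by
      simpa using Real.rpow_le_rpow_of_exponent_le one_le_two (by linarith : 2 - 2 * s ≤ 1)
    calc |t| * m t ^ 2 ≤ |t| * 1 := by
          gcongr
          exact pow_le_one₀ (hm.pos t).le (hm.le_one t)
      _ = |t| ^ (2 - 2 * s) * |t| ^ (2 * s - 1) := by rw [mul_one, ← hsplit]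
      _ ≤ (2 * N) ^ (2 - 2 * s) * |t| ^ (2 * s - 1) := by
          gcongr
          linarith
      _ = 2 ^ (2 - 2 * s) * N ^ (2 - 2 * s) * |t| ^ (2 * s - 1) := by
          rw [Real.mul_rpow zero_le_two hN.le]
      _ ≤ _ := by gcongr
  · have e1 : (N ^ (1 - s)) ^ 2 = N ^ (2 - 2 * s) := by
      rw [← Real.rpow_natCast, ← Real.rpow_mul hN.le]
      ring_nf
    have e2 : |t| * (|t| ^ (s - 1)) ^ 2 = |t| ^ (2 * s - 1) := by
      rw [← Real.rpow_natCast, ← Real.rpow_mul ht.le]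
      nth_rewrite 1 [← Real.rpow_one |t|]
      rw [← Real.rpow_add ht]
      push_cast
      ring_nf
    rw [hm.eq_rpow t h, mul_pow, mul_left_comm, e1, e2]
    have : 0 ≤ N ^ (2 - 2 * s) * |t| ^ (2 * s - 1) := by positivity
    linarith

lemma hasDerivAt (hm : AdmissibleMultiplier s N c₀ m) (t : ℝ) :
    HasDerivAt m (deriv m t) t :=
  (hm.smooth.differentiable (by norm_num) t).hasDerivAt

lemma hasDerivAt_deriv (hm : AdmissibleMultiplier s N c₀ m) (t : ℝ) :
    HasDerivAt (deriv m) (deriv (deriv m) t) t :=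
  (hm.smooth.differentiable_deriv_two t).hasDerivAt

lemma hasDerivAt_cube_mul_sq (hm : AdmissibleMultiplier s N c₀ m) (t : ℝ) :
    HasDerivAt (fun t => t ^ 3 * m t ^ 2)
      (3 * t ^ 2 * m t ^ 2 + 2 * t ^ 3 * (m t * deriv m t)) t := by
  refine ((hasDerivAt_pow 3 t).fun_mul ((hm.hasDerivAt t).fun_pow 2)).congr_deriv ?_
  push_cast
  ring

lemma hasDerivAt_deriv_cube_mul_sq (hm : AdmissibleMultiplier s N c₀ m) (t : ℝ) :
    HasDerivAt (fun t => 3 * t ^ 2 * m t ^ 2 + 2 * t ^ 3 * (m t * deriv m t))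
      (6 * t * m t ^ 2 + 12 * t ^ 2 * (m t * deriv m t) +
        2 * t ^ 3 * (deriv m t ^ 2 + m t * deriv (deriv m) t)) t := by
  refine ((((hasDerivAt_pow 2 t).const_mul 3).fun_mul ((hm.hasDerivAt t).fun_pow 2)).fun_add
    (((hasDerivAt_pow 3 t).const_mul 2).fun_mul
      ((hm.hasDerivAt t).fun_mul (hm.hasDerivAt_deriv t)))).congr_deriv ?_
  push_cast
  ring

lemma abs_deriv2_cube_mul_sq_le (hm : AdmissibleMultiplier s N c₀ m) (t : ℝ) :
    |6 * t * m t ^ 2 + 12 * t ^ 2 * (m t * deriv m t) +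
        2 * t ^ 3 * (deriv m t ^ 2 + m t * deriv (deriv m) t)| ≤
      (6 + 14 * c₀ + 2 * c₀ ^ 2) * (|t| * m t ^ 2) := by
  rcases eq_or_ne t 0 with rfl | ht
  · simp
  have hmt := hm.pos t
  have htp : 0 < |t| := abs_pos.2 ht
  have h1 : |t| * |deriv m t| ≤ c₀ * m t := by
    have := hm.deriv_le t ht
    rwa [le_div_iff₀ htp, mul_comm] at this
  have h2 : |t| ^ 2 * |deriv (deriv m) t| ≤ c₀ * m t := by
    have := hm.deriv2_le t ht
    rwa [le_div_iff₀ (by positivity), mul_comm, ← sq_abs] at this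
  calc _ ≤ |6 * t * m t ^ 2| + |12 * t ^ 2 * (m t * deriv m t)| +
        |2 * t ^ 3 * (deriv m t ^ 2 + m t * deriv (deriv m) t)| := abs_add_three _ _ _
    _ ≤ 6 * |t| * m t ^ 2 + 12 * |t| ^ 2 * (m t * |deriv m t|) +
        2 * |t| ^ 3 * (|deriv m t| ^ 2 + m t * |deriv (deriv m) t|) := by
      have h3 : |deriv m t ^ 2 + m t * deriv (deriv m) t| ≤
          |deriv m t| ^ 2 + m t * |deriv (deriv m) t| := by
        refine (abs_add_le _ _).trans_eq ?_
        rw [abs_pow, abs_mul, abs_of_pos hmt]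
      simp only [abs_mul _ (_ + _), abs_mul, abs_pow, abs_of_pos hmt, Nat.abs_ofNat] at h3 ⊢
      gcongr
    _ = 6 * (|t| * m t ^ 2) + 12 * (|t| * m t) * (|t| * |deriv m t|) +
        2 * |t| * (|t| * |deriv m t|) ^ 2 +
        2 * (|t| * m t) * (|t| ^ 2 * |deriv (deriv m) t|) := by ring
    _ ≤ 6 * (|t| * m t ^ 2) + 12 * (|t| * m t) * (c₀ * m t) +
        2 * |t| * (c₀ * m t) ^ 2 + 2 * (|t| * m t) * (c₀ * m t) := by gcongr
    _ = _ := by ring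

end AdmissibleMultiplier

/-- Lemma 3.2, bound for `M₄₁(ξ₁,ξ₂,ξ₃,ξ₄) = ½(ξ₁+ξ₄)·σ₃(ξ₁+ξ₄,ξ₂,ξ₃)`:
`|M₄₁| ≤ C·N_max^{2s-1}·N^{2-2s}` with `C = C(s, c₀)`. -/
theorem M41_bound (s c₀ : ℝ) (hs : 3 / 4 ≤ s) (hs1 : s < 1) (hc₀ : 0 < c₀) :
    ∃ C : ℝ, 0 < C ∧
      ∀ N : ℝ, 1 ≤ N → ∀ m₁ : ℝ → ℝ, AdmissibleMultiplier s N c₀ m₁ →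
        ∀ ξ₁ ξ₂ ξ₃ ξ₄ : ℝ, ξ₁ + ξ₂ + ξ₃ + ξ₄ = 0 →
          alpha3 (ξ₁ + ξ₄) ξ₂ ξ₃ ≠ 0 →
          |(1 / 2) * (ξ₁ + ξ₄) * sigma3 m₁ (ξ₁ + ξ₄) ξ₂ ξ₃| ≤
            C * (max |ξ₁| (max |ξ₂| (max |ξ₃| |ξ₄|))) ^ (2 * s - 1) * N ^ (2 - 2 * s) := by
  refine ⟨6 + 14 * c₀ + 2 * c₀ ^ 2, by positivity, ?_⟩
  intro N hN m hm ξ₁ ξ₂ ξ₃ ξ₄ hsum hα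
  have hN0 : 0 < N := by linarith
  set M := max |ξ₁| (max |ξ₂| (max |ξ₃| |ξ₄|)) with hM
  have h2M : |ξ₂| ≤ M := by simp [hM]
  have h3M : |ξ₃| ≤ M := by simp [hM]
  have hM0 : 0 ≤ M := (abs_nonneg _).trans h2M
  set B := (6 + 14 * c₀ + 2 * c₀ ^ 2) * (4 * N ^ (2 - 2 * s) * M ^ (2 * s - 1)) with hB
  have hη : ξ₁ + ξ₄ = -(ξ₂ + ξ₃) := by linarith
  have hbound : ∀ t, |t| ≤ 2 * M → |t| * m t ^ 2 ≤ 4 * N ^ (2 - 2 * s) * M ^ (2 * s - 1) := by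
    intro t ht
    have h2 : (2 : ℝ) ^ (2 * s - 1) ≤ 2 := by
      simpa using Real.rpow_le_rpow_of_exponent_le one_le_two (by linarith : 2 * s - 1 ≤ 1)
    calc _ ≤ 2 * N ^ (2 - 2 * s) * |t| ^ (2 * s - 1) :=
          hm.abs_mul_sq_le (by linarith) hs1 hN0 t
      _ ≤ 2 * N ^ (2 - 2 * s) * (2 * M) ^ (2 * s - 1) := by
          gcongr
          linarith
      _ = 2 * N ^ (2 - 2 * s) * (2 ^ (2 * s - 1) * M ^ (2 * s - 1)) := by
          rw [Real.mul_rpow zero_le_two hM0]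
      _ ≤ 2 * N ^ (2 - 2 * s) * (2 * M ^ (2 * s - 1)) := by gcongr
      _ = _ := by ring
  have hdiff := abs_add_sub_two_mul_midpoint_le (R := 2 * M) (K := B)
    hm.hasDerivAt_cube_mul_sq hm.hasDerivAt_deriv_cube_mul_sq
    (fun t ht => (hm.abs_deriv2_cube_mul_sq_le t).trans 
      (mul_le_mul_of_nonneg_left (hbound t ht) (by positivity)))
    (a := ξ₂) (b := ξ₃) (by linarith) (by linarith)
  have hα' : alpha3 (ξ₁ + ξ₄) ξ₂ ξ₃ = 3 * (ξ₂ + ξ₃) * (ξ₂ - ξ₃) ^ 2 := by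
    rw [alpha3, hη]
    ring
  rw [hα'] at hα
  have hadd : ξ₂ + ξ₃ ≠ 0 := fun h => hα (by simp [h])
  have hsub : ξ₂ - ξ₃ ≠ 0 := fun h => hα (by simp [h])
  have hM41 : (1 / 2) * (ξ₁ + ξ₄) * sigma3 m (ξ₁ + ξ₄) ξ₂ ξ₃ =
      -((2 * ξ₂) ^ 3 * m (2 * ξ₂) ^ 2 + (2 * ξ₃) ^ 3 * m (2 * ξ₃) ^ 2 -
        2 * ((ξ₂ + ξ₃) ^ 3 * m (ξ₂ + ξ₃) ^ 2)) / (12 * (ξ₂ - ξ₃) ^ 2) := by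
    rw [sigma3, hα', hη, hm.even]
    field_simp
    ring
  rw [hM41, abs_div, abs_neg, abs_of_pos (by positivity : 0 < 12 * (ξ₂ - ξ₃) ^ 2),
    div_le_iff₀ (by positivity)]
  have hBM : (6 + 14 * c₀ + 2 * c₀ ^ 2) * M ^ (2 * s - 1) * N ^ (2 - 2 * s) = B / 4 := by
    rw [hB]
    ring
  have hB0 : 0 ≤ B := by positivity
  rw [hBM]
  linarith [mul_nonneg hB0 (sq_nonneg (ξ₂ - ξ₃))]
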